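/- Let d ≥ 2 and m > 1, and let Π_1, …, Π_m be a collection of pairwise disjoint distance-d partition systems for Z_n (each with a fixed choice function) such that hd(M^i, M^j) ≥ d−1 for all 1 ≤ i < j ≤ m, where M^i is the list of permutation sets of Π_i. Let A = ext(Π_1) ∪ ext(Π_2) ∪ … ∪ ext(Π_m). Then: (1) hd(ext(Π_i), ext(Π_j)) ≥ d−1 for all 1 ≤ i < j ≤ m; (2) A is a set of permutations of Z_{n+1}; (3) |A| = Σ_{i=1}^m |ext(Π_i)|; and (4) hd(A) ≥ d−1. -/

import Mathlib

/-- Extend a permutation of `Fin n` to a permutation of `Fin (n+1)` fixing the new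
last element `n`. -/
def extFix {n : ℕ} (σ : Equiv.Perm (Fin n)) : Equiv.Perm (Fin (n + 1)) :=
  σ.viaFintypeEmbedding ⟨Fin.castSucc, Fin.castSucc_injective n⟩

/-- The extension `ext_k(σ)` of a permutation `σ` of `Z_n` by position `k`:
it sends `k ↦ n`, `n ↦ σ k`, and `j ↦ σ j` for every other `j < n`. -/
def extPerm {n : ℕ} (σ : Equiv.Perm (Fin n)) (k : Fin n) : Equiv.Perm (Fin (n + 1)) :=
  Equiv.swap (Fin.castSucc (σ k)) (Fin.last n) * extFix σ

/-- A distance-`d` partition system for `Z_n`, together with a fixed choice function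
designating a covering position for each covered permutation. -/
structure PartitionSystem (n s d : ℕ) where
  /-- the list `M_1, …, M_{s+1}` of pairwise disjoint sets of permutations -/
  M : Fin (s + 1) → Finset (Equiv.Perm (Fin n))
  /-- the ordered partition of positions `P_1, …, P_s` -/
  P : Fin s → Finset (Fin n)
  /-- the ordered partition of symbols `Q_1, …, Q_s` -/
  Q : Fin s → Finset (Fin n)
  M_disjoint : ∀ i j, i ≠ j → Disjoint (M i) (M j)
  P_disjoint : ∀ i j, i ≠ j → Disjoint (P i) (P j)
  P_cover : ∀ x : Fin n, ∃ i, x ∈ P i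
  Q_disjoint : ∀ i j, i ≠ j → Disjoint (Q i) (Q j)
  Q_cover : ∀ x : Fin n, ∃ i, x ∈ Q i
  /-- Property (I): `hd(M_i) ≥ d` -/
  hd_intra : ∀ i, ∀ σ ∈ M i, ∀ τ ∈ M i, σ ≠ τ → d ≤ hammingDist ⇑σ ⇑τ
  /-- Property (II): `hd(M_i, M_j) ≥ d − 1` for `i ≠ j` -/
  hd_inter : ∀ i j, i ≠ j → ∀ σ ∈ M i, ∀ τ ∈ M j, d - 1 ≤ hammingDist ⇑σ ⇑τ
  /-- the choice function designating a covering position for each covered permutation -/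
  choice : Fin s → Equiv.Perm (Fin n) → Fin n
  choice_spec : ∀ i σ, (∃ p ∈ P i, σ p ∈ Q i) →
    choice i σ ∈ P i ∧ σ (choice i σ) ∈ Q i

/-- The extended array `ext(Π)`: all `ext_{p_σ}(σ)` for covered `σ ∈ M_i` (`1 ≤ i ≤ s`),
together with the extensions of all `σ ∈ M_{s+1}` by the fixed point `n ↦ n`. -/
def extSet {n s d : ℕ} (Ps : PartitionSystem n s d) :
    Finset (Equiv.Perm (Fin (n + 1))) :=
  ((Finset.univ : Finset (Fin s)).biUnion fun i =>
    ((Ps.M i.castSucc).filter fun σ => ∃ p ∈ Ps.P i, σ p ∈ Ps.Q i).image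
      fun σ => extPerm σ (Ps.choice i σ))
  ∪ (Ps.M (Fin.last s)).image extFix

/-- `IsContraction σ' σ` says that `σ` arises from the permutation `σ'` of `Z_{n+1}` by removing
the point `n` from its cycle. -/
def IsContraction {n : ℕ} (σ' : Equiv.Perm (Fin (n + 1))) (σ : Equiv.Perm (Fin n)) : Prop :=
  ∀ j : Fin n, (σ j).castSucc =
    if σ' j.castSucc = Fin.last n then σ' (Fin.last n) else σ' j.castSucc

theorem extFix_castSucc {n : ℕ} (σ : Equiv.Perm (Fin n)) (j : Fin n) :
    extFix σ j.castSucc = (σ j).castSucc :=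
  Equiv.Perm.viaFintypeEmbedding_apply_image σ ⟨Fin.castSucc, Fin.castSucc_injective n⟩ j

theorem extFix_last {n : ℕ} (σ : Equiv.Perm (Fin n)) : extFix σ (Fin.last n) = Fin.last n := by
  refine Equiv.Perm.viaFintypeEmbedding_apply_notMem_range σ
    ⟨Fin.castSucc, Fin.castSucc_injective n⟩ ?_
  rintro ⟨j, hj⟩
  exact Fin.castSucc_ne_last j hj

theorem isContraction_extFix {n : ℕ} (σ : Equiv.Perm (Fin n)) : IsContraction (extFix σ) σ := by
  intro j
  rw [extFix_castSucc, if_neg (Fin.castSucc_ne_last _)]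

theorem isContraction_extPerm {n : ℕ} (σ : Equiv.Perm (Fin n)) (k : Fin n) :
    IsContraction (extPerm σ k) σ := by
  intro j
  simp only [extPerm, Equiv.Perm.mul_apply, extFix_castSucc, extFix_last, Equiv.swap_apply_right]
  by_cases hjk : j = k
  · simp [hjk]
  · have h : (σ j).castSucc ≠ (σ k).castSucc := by simpa using hjk
    rw [Equiv.swap_apply_of_ne_of_ne h (Fin.castSucc_ne_last _),
      if_neg (Fin.castSucc_ne_last _)]

/-- Contraction does not increase the Hamming distance. -/
theorem IsContraction.hammingDist_le {n : ℕ} {σ' τ' : Equiv.Perm (Fin (n + 1))}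
    {σ τ : Equiv.Perm (Fin n)} (hσ : IsContraction σ' σ) (hτ : IsContraction τ' τ) :
    hammingDist ⇑σ ⇑τ ≤ hammingDist ⇑σ' ⇑τ' := by
  have key : ∀ j, σ j ≠ τ j → σ' j.castSucc = τ' j.castSucc →
      σ' j.castSucc = Fin.last n ∧ σ' (Fin.last n) ≠ τ' (Fin.last n) := by
    intro j hj he
    have hne : (σ j).castSucc ≠ (τ j).castSucc := by simpa using hj
    rw [hσ j, hτ j, ← he] at hne
    split_ifs at hne with h
    · exact ⟨h, hne⟩
    · exact absurd rfl hne
  refine Finset.card_le_card_of_injOn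
    (fun j => if σ' j.castSucc = τ' j.castSucc then Fin.last n else j.castSucc) ?_ ?_
  · intro j hj
    have hj : σ j ≠ τ j := by simpa using hj
    simp only [Finset.coe_filter, Finset.mem_univ, true_and, Set.mem_ofPred_eq]
    split_ifs with h
    · exact (key j hj h).2
    · exact h
  · intro i hi j hj hij
    have hi : σ i ≠ τ i := by simpa using hi
    have hj : σ j ≠ τ j := by simpa using hj
    dsimp only at hij
    split_ifs at hij with h₁ h₂ h₂
    · exact Fin.castSucc_injective n
        (σ'.injective ((key i hi h₁).1.trans (key j hj h₂).1.symm))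
    · exact absurd hij.symm (Fin.castSucc_ne_last j)
    · exact absurd hij (Fin.castSucc_ne_last i)
    · exact Fin.castSucc_injective n hij

namespace PartitionSystem

variable {n s d : ℕ} (Ps : PartitionSystem n s d)

/-- The extension of `σ` prescribed for members of the `a`-th set of the list. -/
def extend (a : Fin (s + 1)) (σ : Equiv.Perm (Fin n)) : Equiv.Perm (Fin (n + 1)) :=
  Fin.lastCases (motive := fun _ => Equiv.Perm (Fin (n + 1))) (extFix σ)
    (fun i => extPerm σ (Ps.choice i σ)) a

theorem isContraction_extend (a : Fin (s + 1)) (σ : Equiv.Perm (Fin n)) :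
    IsContraction (Ps.extend a σ) σ := by
  induction a using Fin.lastCases with
  | last => simpa [extend] using isContraction_extFix σ
  | cast i => simpa [extend] using isContraction_extPerm σ _

theorem exists_extend_eq_of_mem_extSet {σ' : Equiv.Perm (Fin (n + 1))} (h : σ' ∈ extSet Ps) :
    ∃ a, ∃ σ ∈ Ps.M a, Ps.extend a σ = σ' := by
  simp only [extSet, Finset.mem_union, Finset.mem_biUnion, Finset.mem_univ, true_and,
    Finset.mem_image, Finset.mem_filter] at h
  obtain ⟨i, σ, ⟨hσ, -⟩, rfl⟩ | ⟨σ, hσ, rfl⟩ := h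
  · exact ⟨i.castSucc, σ, hσ, by simp [extend]⟩
  · exact ⟨Fin.last s, σ, hσ, by simp [extend]⟩

theorem le_hammingDist_of_mem_extSet {σ' τ' : Equiv.Perm (Fin (n + 1))}
    (hσ' : σ' ∈ extSet Ps) (hτ' : τ' ∈ extSet Ps) (hne : σ' ≠ τ') :
    d - 1 ≤ hammingDist ⇑σ' ⇑τ' := by
  obtain ⟨a, σ, hσ, rfl⟩ := Ps.exists_extend_eq_of_mem_extSet hσ'
  obtain ⟨b, τ, hτ, rfl⟩ := Ps.exists_extend_eq_of_mem_extSet hτ'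
  refine le_trans ?_ ((Ps.isContraction_extend a σ).hammingDist_le (Ps.isContraction_extend b τ))
  by_cases hab : a = b
  · subst hab
    have hστ : σ ≠ τ := fun h => hne (by rw [h])
    exact (Nat.sub_le d 1).trans (Ps.hd_intra a σ hσ τ hτ hστ)
  · exact Ps.hd_inter a b hab σ hσ τ hτ

end PartitionSystem

/-- **Corollary.** Let `d ≥ 2`, `m > 1`, and let `Π₁, …, Π_m` be pairwise disjoint
distance-`d` partition systems for `Z_n` with `hd(Mⁱ, Mʲ) ≥ d−1` for all `i ≠ j`.
Let `A = ext(Π₁) ∪ … ∪ ext(Π_m)`. Then (1) `hd(ext(Π_i), ext(Π_j)) ≥ d−1` for `i ≠ j`,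
(2) `A` is a set of permutations of `Z_{n+1}`, (3) `|A| = Σ_i |ext(Π_i)|`, and
(4) `hd(A) ≥ d−1`. -/
theorem iterative_partition_and_extension_general {n m d : ℕ} (hd2 : 2 ≤ d) (hm : 1 < m)
    (s : Fin m → ℕ) (Ps : ∀ i : Fin m, PartitionSystem n (s i) d)
    (hdisj : ∀ i j, i ≠ j → ∀ a b, Disjoint ((Ps i).M a) ((Ps j).M b))
    (hcross : ∀ i j, i ≠ j → ∀ a b, ∀ σ ∈ (Ps i).M a, ∀ τ ∈ (Ps j).M b,
      d - 1 ≤ hammingDist ⇑σ ⇑τ) :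
    (∀ i j, i ≠ j → ∀ σ' ∈ extSet (Ps i), ∀ τ' ∈ extSet (Ps j),
      d - 1 ≤ hammingDist ⇑σ' ⇑τ') ∧
    (Finset.univ.biUnion fun i => extSet (Ps i)).card = ∑ i, (extSet (Ps i)).card ∧
    (∀ σ' ∈ Finset.univ.biUnion fun i => extSet (Ps i),
      ∀ τ' ∈ Finset.univ.biUnion fun i => extSet (Ps i),
        σ' ≠ τ' → d - 1 ≤ hammingDist ⇑σ' ⇑τ') := by
  have cross : ∀ i j, i ≠ j → ∀ σ' ∈ extSet (Ps i), ∀ τ' ∈ extSet (Ps j),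
      d - 1 ≤ hammingDist ⇑σ' ⇑τ' := by
    intro i j hij σ' hσ' τ' hτ'
    obtain ⟨a, σ, hσ, rfl⟩ := (Ps i).exists_extend_eq_of_mem_extSet hσ'
    obtain ⟨b, τ, hτ, rfl⟩ := (Ps j).exists_extend_eq_of_mem_extSet hτ'
    exact (hcross i j hij a b σ hσ τ hτ).trans
      (((Ps i).isContraction_extend a σ).hammingDist_le ((Ps j).isContraction_extend b τ))
  refine ⟨cross, Finset.card_biUnion ?_, ?_⟩
  · intro i _ j _ hij
    refine Finset.disjoint_left.mpr fun σ' hi hj => ?_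
    have h := cross i j hij σ' hi σ' hj
    rw [hammingDist_self] at h
    omega
  · intro σ' hσ' τ' hτ' hne
    obtain ⟨i, -, hi⟩ := Finset.mem_biUnion.mp hσ'
    obtain ⟨j, -, hj⟩ := Finset.mem_biUnion.mp hτ'
    by_cases hij : i = j
    · subst hij
      exact (Ps i).le_hammingDist_of_mem_extSet hi hj hne
    · exact cross i j hij σ' hi τ' hj
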